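/- There exist a constant c₁>0 and b₀>0 such that for all b>b₀ and all k≥1 (for which n_kF̄(b+n_{k-1}μ)<1, which holds automatically for b>b₀): exp( n_k · Λ_k(θ_k(b)) ) ≤ c₁. -/

import Mathlib

open MeasureTheory ProbabilityTheory Filter

noncomputable section

/-- Right tail `F̄(x) = F((x,∞))` of a measure on `ℝ`, as a real number. -/
def rtail (F : Measure ℝ) (x : ℝ) : ℝ := (F (Set.Ioi x)).toReal

/-- `L` is slowly varying at infinity. -/
def SlowlyVarying (L : ℝ → ℝ) : Prop :=
  ∀ t > 0, Tendsto (fun x => L (t * x) / L x) atTop (nhds 1)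

/-- The block sizes `n_0 = 0`, `n_k = r^k` for `k ≥ 1`. -/
def nseq (r k : ℕ) : ℕ := if k = 0 then 0 else r ^ k

/-- The twisting parameter `θ_k(b) = −log(n_k F̄(b + n_{k-1}μ)) / (b + n_{k-1}μ)`. -/
def thetaK (F : Measure ℝ) (μ : ℝ) (r k : ℕ) (b : ℝ) : ℝ :=
  -Real.log ((nseq r k : ℝ) * rtail F (b + (nseq r (k - 1) : ℝ) * μ)) /
    (b + (nseq r (k - 1) : ℝ) * μ)

/-- `Λ_k(θ) = log ∫_{(-∞, b + n_{k-1}μ)} e^{θx} dF(x)`. -/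
def LamK (F : Measure ℝ) (c θ : ℝ) : ℝ :=
  Real.log (∫ x in Set.Iio c, Real.exp (θ * x) ∂F)

lemma rtail_nonneg (F : Measure ℝ) (x : ℝ) : 0 ≤ rtail F x := ENNReal.toReal_nonneg

lemma rtail_antitone (F : Measure ℝ) [IsProbabilityMeasure F] : Antitone (rtail F) :=
  fun _ _ h => ENNReal.toReal_mono (measure_ne_top _ _) (measure_mono (Set.Ioi_subset_Ioi h))

/-- A regularly varying tail satisfies a doubling condition. -/
lemma exists_rtail_doubling {F : Measure ℝ} {α : ℝ} {L : ℝ → ℝ} (hLpos : ∀ x > 0, 0 < L x)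
    (hL : SlowlyVarying L) (htail : ∀ x > 0, rtail F x = L x * x ^ (-α)) :
    ∃ D > (0 : ℝ), ∃ x₀ > (0 : ℝ), ∀ x ≥ x₀, rtail F x ≤ D * rtail F (2 * x) := by
  have h := (hL 2 two_pos).eventually_const_le (show (1 / 2 : ℝ) < 1 by norm_num)
  obtain ⟨a, ha⟩ := eventually_atTop.1 h
  refine ⟨2 * 2 ^ α, by positivity, max a 1, by positivity, fun x hx => ?_⟩
  have hx0 : 0 < x := lt_of_lt_of_le one_pos ((le_max_right _ _).trans hx)
  have h1 := ha x ((le_max_left _ _).trans hx)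
  rw [le_div_iff₀ (hLpos x hx0)] at h1
  rw [htail x hx0, htail (2 * x) (by positivity), Real.mul_rpow two_pos.le hx0.le]
  have h2 : (2 : ℝ) ^ α * 2 ^ (-α) = 1 := by
    rw [← Real.rpow_add two_pos]; simp
  have h3 : 0 < x ^ (-α) := Real.rpow_pos_of_pos hx0 _
  calc L x * x ^ (-α) ≤ (2 * L (2 * x)) * x ^ (-α) := by gcongr; linarith
    _ = 2 * (2 ^ α * 2 ^ (-α)) * L (2 * x) * x ^ (-α) := by rw [h2]; ring
    _ = _ := by ring

lemma le_pow_mul_of_doubling {f : ℝ → ℝ} {D x₀ : ℝ} (hD : 0 < D) (hx₀ : 0 < x₀)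
    (h : ∀ x ≥ x₀, f x ≤ D * f (2 * x)) (j : ℕ) {x : ℝ} (hx : x₀ ≤ x) :
    f x ≤ D ^ j * f (2 ^ j * x) := by
  induction j with
  | zero => simp
  | succ j ih =>
    have h1 : x₀ ≤ 2 ^ j * x :=
      hx.trans (le_mul_of_one_le_left (hx₀.le.trans hx) (one_le_pow₀ one_le_two))
    calc f x ≤ D ^ j * f (2 ^ j * x) := ih
      _ ≤ D ^ j * (D * f (2 * (2 ^ j * x))) := by gcongr; exact h _ h1
      _ = _ := by rw [pow_succ, pow_succ']; ring_nf

/-- A positive nonincreasing function with the doubling property decays at most polynomially. -/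
lemma eventually_neg_log_le_rpow {f : ℝ → ℝ} (hf : Antitone f) (hpos : ∀ x > 0, 0 < f x)
    {D x₀ : ℝ} (hD : 0 < D) (hx₀ : 0 < x₀) (h : ∀ x ≥ x₀, f x ≤ D * f (2 * x))
    {ε : ℝ} (hε : 0 < ε) : ∀ᶠ c in atTop, -Real.log (f c) ≤ c ^ ε := by
  set B := |Real.log D| / Real.log 2 with hB
  set A := -Real.log (f x₀) + |Real.log D| - B * Real.log x₀ with hA
  have hlog2 : 0 < Real.log 2 := Real.log_pos one_lt_two
  have hlim : (fun c => A + B * Real.log c) =o[atTop] fun c : ℝ => c ^ ε := by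
    refine Asymptotics.IsLittleO.add ?_ ((isLittleO_log_rpow_atTop hε).const_mul_left B)
    exact Asymptotics.isLittleO_const_left.2
      (Or.inr (tendsto_norm_atTop_atTop.comp (tendsto_rpow_atTop hε)))
  filter_upwards [hlim.bound one_pos, eventually_ge_atTop x₀] with c hc hc0
  have hcpos : 0 < c := hx₀.trans_le hc0
  rw [one_mul, Real.norm_eq_abs, Real.norm_of_nonneg (Real.rpow_nonneg hcpos.le _)] at hc
  refine le_trans ?_ ((le_abs_self _).trans hc)
  obtain ⟨j, hj1, hj2⟩ := exists_nat_pow_near ((one_le_div hx₀).2 hc0) (one_lt_two (α := ℝ))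
  have hj3 : c ≤ 2 ^ (j + 1) * x₀ := ((div_lt_iff₀ hx₀).1 hj2).le
  have h1 : f x₀ ≤ D ^ (j + 1) * f c := (le_pow_mul_of_doubling hD hx₀ h _ le_rfl).trans
    (by gcongr; exact hf hj3)
  have h2 := Real.log_le_log (hpos _ hx₀) h1
  rw [Real.log_mul (by positivity) (hpos _ hcpos).ne', Real.log_pow] at h2
  have h3 := Real.log_le_log (by positivity) hj1
  rw [Real.log_pow, Real.log_div hcpos.ne' hx₀.ne'] at h3
  have h4 : (j : ℝ) * |Real.log D| ≤ B * (Real.log c - Real.log x₀) := by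
    calc (j : ℝ) * |Real.log D| = B * (j * Real.log 2) := by rw [hB]; field_simp
      _ ≤ _ := by gcongr
  have h5 : ((j + 1 : ℕ) : ℝ) * Real.log D ≤ (j + 1 : ℕ) * |Real.log D| := by
    gcongr; exact le_abs_self _
  push_cast at h2 h5
  rw [hA]; linarith

lemma exp_le_one_add_add_rpow {κ y : ℝ} (h1 : 1 ≤ κ) (h2 : κ ≤ 2) (hy : y ≤ 1) :
    Real.exp y ≤ 1 + y + 2 * |y| ^ κ := by
  rcases le_or_gt (-1) y with h | h
  · have hy1 : |y| ≤ 1 := abs_le.2 ⟨h, hy⟩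
    have h3 := (abs_le.1 (Real.abs_exp_sub_one_sub_id_le hy1)).2
    have h4 : y ^ 2 ≤ |y| ^ κ := by
      rcases eq_or_ne y 0 with rfl | h0
      · simpa using Real.rpow_nonneg le_rfl κ
      · rw [← sq_abs, ← Real.rpow_natCast]
        exact Real.rpow_le_rpow_of_exponent_ge (abs_pos.2 h0) hy1 (by exact_mod_cast h2)
    linarith [sq_nonneg y]
  · have h3 : |y| ≤ |y| ^ κ := Real.self_le_rpow_of_one_le (by rw [abs_of_neg (by linarith)]; linarith) h1
    have h4 : Real.exp y ≤ 1 := Real.exp_le_one_iff.2 (by linarith)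
    linarith [neg_le_abs y, abs_nonneg y]

/-- Dyadic majorant of the truncated exponential. -/
lemma indicator_exp_le {κ θ c : ℝ} (h1 : 1 ≤ κ) (h2 : κ ≤ 2) (hθ : 0 < θ) (hc : 0 < c)
    {m : ℕ} (hm : θ * c < 2 ^ (m + 1)) (x : ℝ) :
    (Set.Iio c).indicator (fun x => Real.exp (θ * x)) x ≤ 1 + θ * x + 2 * θ ^ κ * |x| ^ κ +
      ∑ j ∈ Finset.range (m + 1),
        (Set.Ioi (c / 2 ^ (j + 1))).indicator (fun _ => Real.exp (θ * c / 2 ^ j)) x := by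
  have hnn : ∀ j ∈ Finset.range (m + 1),
      0 ≤ (Set.Ioi (c / 2 ^ (j + 1))).indicator (fun _ => Real.exp (θ * c / 2 ^ j)) x :=
    fun j _ => Set.indicator_nonneg (fun _ _ => (Real.exp_pos _).le) _
  have hs := Finset.sum_nonneg hnn
  have hp : 0 ≤ 2 * θ ^ κ * |x| ^ κ := by positivity
  rcases le_or_gt c x with hcx | hcx
  · rw [Set.indicator_of_notMem (by simpa using hcx)]
    have : 0 < θ * x := mul_pos hθ (hc.trans_le hcx)
    linarith
  rw [Set.indicator_of_mem (Set.mem_Iio.2 hcx)]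
  rcases le_or_gt (θ * x) 1 with hy | hy
  · have h3 := exp_le_one_add_add_rpow h1 h2 hy
    rw [abs_mul, abs_of_pos hθ, Real.mul_rpow hθ.le (abs_nonneg x)] at h3
    linarith
  have hx : 0 < x := by
    by_contra! h
    linarith [mul_nonpos_of_nonneg_of_nonpos hθ.le h]
  obtain ⟨j, hj1, hj2⟩ := exists_nat_pow_near ((one_le_div hx).2 hcx.le) (one_lt_two (α := ℝ))
  have hjm : j ∈ Finset.range (m + 1) := by
    have h3 : c / x < θ * c := by rw [div_lt_iff₀ hx]; nlinarith
    exact Finset.mem_range.2 ((pow_lt_pow_iff_right₀ (one_lt_two (α := ℝ))).1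
      (hj1.trans_lt (h3.trans hm)))
  have h4 : x ∈ Set.Ioi (c / 2 ^ (j + 1)) := by
    rw [Set.mem_Ioi, div_lt_iff₀ (by positivity)]
    rw [div_lt_iff₀ hx] at hj2
    linarith
  have h5 := Finset.single_le_sum hnn hjm
  rw [Set.indicator_of_mem h4] at h5
  have h6 : Real.exp (θ * x) ≤ Real.exp (θ * c / 2 ^ j) := by
    rw [Real.exp_le_exp, mul_div_assoc]
    gcongr
    rw [le_div_iff₀ hx] at hj1
    rw [le_div_iff₀ (by positivity)]
    linarith
  have : 0 < θ * x := mul_pos hθ hx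
  linarith

lemma LamK_le {F : Measure ℝ} [IsProbabilityMeasure F] {κ θ c : ℝ} (h1 : 1 ≤ κ) (h2 : κ ≤ 2)
    (hθ : 0 < θ) (hc : 0 < c) (hmeanInt : Integrable (fun x => x) F) (hmean : ∫ x, x ∂F = 0)
    (hmom : Integrable (fun x => |x| ^ κ) F) {m : ℕ} (hm : θ * c < 2 ^ (m + 1)) :
    LamK F c θ ≤ 2 * θ ^ κ * ∫ x, |x| ^ κ ∂F +
      ∑ j ∈ Finset.range (m + 1), rtail F (c / 2 ^ (j + 1)) * Real.exp (θ * c / 2 ^ j) := by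
  have hI : ∀ j ∈ Finset.range (m + 1), Integrable
      ((Set.Ioi (c / 2 ^ (j + 1))).indicator (fun _ => Real.exp (θ * c / 2 ^ j))) F :=
    fun j _ => (integrable_const _).indicator measurableSet_Ioi
  have hA : Integrable (fun x => 1 + θ * x) F := (integrable_const _).add (hmeanInt.const_mul _)
  have hB : Integrable (fun x => 2 * θ ^ κ * |x| ^ κ) F := hmom.const_mul _
  have hint := (hA.add hB).add (integrable_finsetSum _ hI)
  have hE : ∫ x in Set.Iio c, Real.exp (θ * x) ∂F ≤ 1 + (2 * θ ^ κ * ∫ x, |x| ^ κ ∂F +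
      ∑ j ∈ Finset.range (m + 1), rtail F (c / 2 ^ (j + 1)) * Real.exp (θ * c / 2 ^ j)) := by
    rw [← integral_indicator measurableSet_Iio]
    refine (integral_mono_of_nonneg (ae_of_all _ fun x =>
      Set.indicator_nonneg (fun _ _ => (Real.exp_pos _).le) x) hint
      (ae_of_all _ fun x => ?_)).trans_eq ?_
    · simpa using indicator_exp_le h1 h2 hθ hc hm x
    · rw [integral_add' (hA.add hB) (integrable_finsetSum _ hI), integral_add' hA hB,
        integral_add (integrable_const _) (hmeanInt.const_mul _), integral_const_mul,
        integral_const_mul, hmean, integral_finsetSum _ hI]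
      simp only [integral_indicator_const _ measurableSet_Ioi, rtail, measureReal_def]
      simp [add_assoc]
  have hR : 0 ≤ 2 * θ ^ κ * ∫ x, |x| ^ κ ∂F +
      ∑ j ∈ Finset.range (m + 1), rtail F (c / 2 ^ (j + 1)) * Real.exp (θ * c / 2 ^ j) := by
    have h3 : 0 ≤ ∫ x, |x| ^ κ ∂F := integral_nonneg fun x => by positivity
    have h4 : ∀ x, 0 ≤ rtail F x := rtail_nonneg F
    refine add_nonneg (by positivity) (Finset.sum_nonneg fun j _ => ?_)
    exact mul_nonneg (h4 _) (Real.exp_pos _).le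
  rcases (setIntegral_nonneg (μ := F) (measurableSet_Iio (a := c))
    fun x _ => (Real.exp_pos (θ * x)).le).eq_or_lt' with h0 | h0
  · rw [LamK, h0, Real.log_zero]; exact hR
  · rw [LamK]; linarith [Real.log_le_sub_one_of_pos h0]

lemma summable_pow_mul_exp_neg_two_pow {D : ℝ} (hD : 0 < D) :
    Summable fun j : ℕ => D ^ (j + 1) * Real.exp (-(2 ^ j - 1)) := by
  refine summable_of_ratio_test_tendsto_lt_one (l := 0) one_pos
    (Eventually.of_forall fun j => by positivity) ?_
  have h : Tendsto (fun j : ℕ => D * Real.exp (-(2 : ℝ) ^ j)) atTop (nhds (D * 0)) :=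
    (Real.tendsto_exp_neg_atTop_nhds_zero.comp
      (tendsto_pow_atTop_atTop_of_one_lt one_lt_two)).const_mul D
  rw [mul_zero] at h
  refine h.congr fun j => ?_
  rw [Real.norm_of_nonneg (by positivity), Real.norm_of_nonneg (by positivity),
    eq_div_iff (by positivity)]
  have h1 : Real.exp (-(2 ^ (j + 1) - 1)) = Real.exp (-(2 : ℝ) ^ j) * Real.exp (-(2 ^ j - 1)) := by
    rw [← Real.exp_add]; ring_nf
  rw [h1]; ring

lemma mul_sum_rtail_le {F : Measure ℝ} {D x₀ n c T : ℝ} (hD : 0 < D) (hx₀ : 0 < x₀)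
    (h : ∀ x ≥ x₀, rtail F x ≤ D * rtail F (2 * x)) (hn : 0 ≤ n)
    (hT : Real.exp (-T) = n * rtail F c) (hcT : 2 * x₀ * T ≤ c) {m : ℕ} (hm : 2 ^ m ≤ T) :
    n * ∑ j ∈ Finset.range (m + 1), rtail F (c / 2 ^ (j + 1)) * Real.exp (T / 2 ^ j) ≤
      ∑' j : ℕ, D ^ (j + 1) * Real.exp (-(2 ^ j - 1)) := by
  rw [Finset.mul_sum]
  refine (Finset.sum_le_sum fun j hj => ?_).trans
    ((summable_pow_mul_exp_neg_two_pow hD).sum_le_tsum _ fun j _ => by positivity)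
  have hjT : (2 : ℝ) ^ j ≤ T :=
    (pow_le_pow_right₀ one_le_two (Finset.mem_range_succ_iff.1 hj)).trans hm
  have h1 : x₀ ≤ c / 2 ^ (j + 1) := by
    rw [le_div_iff₀ (by positivity), pow_succ]
    nlinarith
  have h2 := le_pow_mul_of_doubling hD hx₀ h (j + 1) h1
  rw [mul_div_cancel₀ _ (by positivity)] at h2
  have h3 : -T + T / 2 ^ j ≤ -(2 ^ j - 1) := by
    have h4 : (1 : ℝ) ≤ 2 ^ j := one_le_pow₀ one_le_two
    have h5 : T / 2 ^ j * 2 ^ j = T := div_mul_cancel₀ _ (by positivity)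
    have h6 : 1 ≤ T / 2 ^ j := (one_le_div (by positivity)).2 hjT
    nlinarith
  calc n * (rtail F (c / 2 ^ (j + 1)) * Real.exp (T / 2 ^ j))
      ≤ n * (D ^ (j + 1) * rtail F c * Real.exp (T / 2 ^ j)) := by gcongr
    _ = D ^ (j + 1) * Real.exp (-T + T / 2 ^ j) := by rw [Real.exp_add, hT]; ring
    _ ≤ _ := by gcongr

lemma tendsto_mul_rtail {F : Measure ℝ} [IsProbabilityMeasure F] {κ : ℝ} (hκ : 1 < κ)
    (hmom : Integrable (fun x => |x| ^ κ) F) :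
    Tendsto (fun c => c * rtail F c) atTop (nhds 0) := by
  have h : Tendsto (fun c : ℝ => (∫ x, |x| ^ κ ∂F) * c ^ (-(κ - 1))) atTop
      (nhds ((∫ x, |x| ^ κ ∂F) * 0)) :=
    (tendsto_rpow_neg_atTop (by linarith)).const_mul _
  rw [mul_zero] at h
  refine squeeze_zero' ?_ ?_ h
  · filter_upwards [eventually_ge_atTop 0] with c hc using mul_nonneg hc (rtail_nonneg F c)
  filter_upwards [eventually_gt_atTop 0] with c hc
  have h1 := mul_meas_ge_le_integral_of_nonneg (ae_of_all F fun x => by positivity) hmom (c ^ κ)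
  have h2 : rtail F c ≤ F.real {x | c ^ κ ≤ |x| ^ κ} := by
    refine ENNReal.toReal_mono (measure_ne_top _ _) (measure_mono fun x hx => ?_)
    exact Real.rpow_le_rpow hc.le ((Set.mem_Ioi.1 hx).le.trans (le_abs_self x)) (by linarith)
  have h3 : c = c ^ κ * c ^ (-(κ - 1)) := by
    rw [← Real.rpow_add hc]; simp
  calc c * rtail F c = c ^ κ * rtail F c * c ^ (-(κ - 1)) := by
        nth_rewrite 1 [h3]; ring
    _ ≤ c ^ κ * F.real {x | c ^ κ ≤ |x| ^ κ} * c ^ (-(κ - 1)) := by gcongr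
    _ ≤ _ := by gcongr

lemma integrable_abs_rpow_of_le {F : Measure ℝ} [IsProbabilityMeasure F] {p q : ℝ} (hp : 0 ≤ p)
    (hpq : p ≤ q) (hq : Integrable (fun x => |x| ^ q) F) : Integrable (fun x => |x| ^ p) F := by
  refine ((integrable_const (1 : ℝ)).add hq).mono' (by fun_prop) (ae_of_all _ fun x => ?_)
  rw [Real.norm_of_nonneg (by positivity)]
  change |x| ^ p ≤ 1 + |x| ^ q
  have hx : 0 ≤ |x| ^ q := by positivity
  rcases le_total |x| 1 with h | h
  · linarith [Real.rpow_le_one (abs_nonneg x) h hp]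
  · linarith [Real.rpow_le_rpow_of_exponent_le h hpq]

lemma nseq_le {r : ℕ} {μ b : ℝ} (hμ : 0 < μ) (hb : 1 ≤ b) {k : ℕ} (hk : 1 ≤ k) :
    (nseq r k : ℝ) ≤ r * (1 + 1 / μ) * (b + (nseq r (k - 1) : ℝ) * μ) := by
  obtain ⟨k, rfl⟩ := Nat.exists_eq_add_of_le' hk
  have h1 : nseq r (k + 1) ≤ r * (nseq r k + 1) := by
    rcases Nat.eq_zero_or_pos k with rfl | h
    · simp [nseq]
    · simp only [nseq, Nat.add_one_ne_zero, if_false, h.ne', pow_succ']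
      exact Nat.mul_le_mul_left _ (Nat.le_succ _)
  have h2 : (nseq r (k + 1) : ℝ) ≤ r * (nseq r k + 1) := by exact_mod_cast h1
  rw [Nat.add_sub_cancel, mul_assoc]
  refine h2.trans ?_
  gcongr
  have h3 : 1 / μ * (nseq r k * μ) = nseq r k := by field_simp
  have h4 : 0 ≤ 1 / μ * b := by positivity
  have h5 : 0 ≤ (nseq r k : ℝ) * μ := by positivity
  linarith

/-- There are `c₁ > 0` and `b₀ > 0` such that for all `b > b₀` and all `k ≥ 1`,
`n_k F̄(b + n_{k-1}μ) < 1` (so `θ_k(b) > 0` is well defined) and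
`exp(n_k Λ_k(θ_k(b))) ≤ c₁`. -/
theorem stmt9
    (F : Measure ℝ) [IsProbabilityMeasure F]
    (α : ℝ) (hα : 1 < α)
    (L : ℝ → ℝ) (hLpos : ∀ x > 0, 0 < L x) (hL : SlowlyVarying L)
    (htail : ∀ x > 0, rtail F x = L x * x ^ (-α))
    (hmeanInt : Integrable (fun x => x) F) (hmean : ∫ x, x ∂F = 0)
    (κ : ℝ) (hκ1 : 1 < κ) (hκα : κ < α)
    (hmom : Integrable (fun x => |x| ^ κ) F)
    (μ : ℝ) (hμ : 0 < μ) (r : ℕ) (hr : 1 < r) :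
    ∃ c₁ > (0 : ℝ), ∃ b₀ > (0 : ℝ), ∀ b > b₀, ∀ k : ℕ, 1 ≤ k →
      ((nseq r k : ℝ) * rtail F (b + (nseq r (k - 1) : ℝ) * μ) < 1) ∧
      Real.exp ((nseq r k : ℝ) *
        LamK F (b + (nseq r (k - 1) : ℝ) * μ) (thetaK F μ r k b)) ≤ c₁ := by
  have hpos : ∀ x > 0, 0 < rtail F x := fun x hx => by
    rw [htail x hx]; exact mul_pos (hLpos x hx) (Real.rpow_pos_of_pos hx _)
  obtain ⟨D, hD, x₀, hx₀, hdbl⟩ := exists_rtail_doubling hLpos hL htail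
  set p := min κ 2 with hp
  have hp1 : 1 < p := lt_min hκ1 one_lt_two
  have hp2 : p ≤ 2 := min_le_right _ _
  have hp0 : 0 < p := by linarith
  have hmomp := integrable_abs_rpow_of_le hp0.le (min_le_left κ 2) hmom
  set ε := (p - 1) / p with hε
  have hε0 : 0 < ε := div_pos (by linarith) hp0
  have hε1 : ε < 1 := (div_lt_one hp0).2 (by linarith)
  set C := r * (1 + 1 / μ) with hC
  set M := ∫ x, |x| ^ p ∂F with hM
  have hM0 : 0 ≤ M := integral_nonneg fun x => by positivity
  set S := ∑' j : ℕ, D ^ (j + 1) * Real.exp (-(2 ^ j - 1))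
  have hsmall : Tendsto (fun c => C * (c * rtail F c)) atTop (nhds 0) := by
    simpa using (tendsto_mul_rtail hp1 hmomp).const_mul C
  obtain ⟨a, ha⟩ := eventually_atTop.1
    ((hsmall.eventually_le_const (Real.exp_pos (-1))).and
      ((eventually_neg_log_le_rpow (rtail_antitone F) hpos hD hx₀ hdbl hε0).and
        ((tendsto_rpow_atTop (sub_pos.2 hε1)).eventually_ge_atTop (2 * x₀))))
  refine ⟨Real.exp (2 * C * M + S), Real.exp_pos _, max a 1, by positivity, fun b hb k hk => ?_⟩
  have hb1 : 1 < b := (le_max_right _ _).trans_lt hb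
  have hnC := nseq_le (r := r) hμ hb1.le hk
  have hcb : b ≤ b + (nseq r (k - 1) : ℝ) * μ := le_add_of_nonneg_right (by positivity)
  unfold thetaK
  set c := b + (nseq r (k - 1) : ℝ) * μ
  have hn1 : (1 : ℝ) ≤ nseq r k := by
    rw [nseq, if_neg (by omega)]
    exact_mod_cast Nat.one_le_pow _ _ (by omega)
  set n := (nseq r k : ℝ)
  obtain ⟨ha1, ha2, ha3⟩ := ha c ((le_max_left _ _).trans (hb.le.trans hcb))
  have hc : 0 < c := by linarith
  have hFc := hpos c hc
  have hnF : n * rtail F c ≤ Real.exp (-1) :=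
    (mul_le_mul_of_nonneg_right hnC hFc.le).trans (by rwa [mul_assoc])
  have hnF0 : 0 < n * rtail F c := by positivity
  refine ⟨hnF.trans_lt (Real.exp_lt_one_iff.2 (by norm_num)), Real.exp_le_exp.2 ?_⟩
  set T := -Real.log (n * rtail F c) with hT
  have hT1 : 1 ≤ T := by
    have := Real.log_le_log hnF0 hnF
    rw [Real.log_exp] at this
    linarith
  have hTc : T ≤ c ^ ε := by
    refine le_trans (neg_le_neg (Real.log_le_log hFc ?_)) ha2
    exact le_mul_of_one_le_left hFc.le hn1
  have hexpT : Real.exp (-T) = n * rtail F c := by rw [hT, neg_neg, Real.exp_log hnF0]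
  have hcT : 2 * x₀ * T ≤ c :=
    calc 2 * x₀ * T ≤ c ^ (1 - ε) * c ^ ε := by gcongr
      _ = c := by rw [← Real.rpow_add hc]; simp
  have hθ : 0 < T / c := by positivity
  have hθc : T / c * c = T := div_mul_cancel₀ _ hc.ne'
  obtain ⟨m, hm1, hm2⟩ := exists_nat_pow_near hT1 (one_lt_two (α := ℝ))
  have hΛ := LamK_le hp1.le hp2 hθ hc hmeanInt hmean hmomp (hθc.trans_lt hm2)
  rw [hθc] at hΛ
  have hmain := mul_sum_rtail_le hD hx₀ hdbl (by linarith : 0 ≤ n) hexpT hcT hm1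
  have hpow : n * (T / c) ^ p ≤ C :=
    calc n * (T / c) ^ p ≤ (C * c) * (c ^ ε / c) ^ p := by gcongr
      _ = C * (c * (c ^ (ε - 1)) ^ p) := by rw [Real.rpow_sub_one hc.ne']; ring
      _ = C * (c ^ (1 : ℝ) * c ^ ((ε - 1) * p)) := by rw [Real.rpow_mul hc.le, Real.rpow_one]
      _ = C * c ^ (1 + (ε - 1) * p) := by rw [← Real.rpow_add hc]
      _ = C := by
        have : 1 + (ε - 1) * p = 0 := by rw [hε]; field_simp; ring
        rw [this, Real.rpow_zero, mul_one]
  rw [← hM] at hΛ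
  have hΛ' := mul_le_mul_of_nonneg_left hΛ (by linarith : 0 ≤ n)
  have hpowM := mul_le_mul_of_nonneg_right hpow hM0
  rw [mul_add] at hΛ'
  linarith
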